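/- Let λ : [b̲, b̄] → ℝ be continuous and let h : [b̲, b̄] → ℝ satisfy 0 < h(b) ≤ M < ∞ for all b. Set a = b̄ − b̲, and for b ∈ [b̲, b̄] and integer q ≥ 2 define M(b,q) = ∫_b^{b+a/q} λ(t) h(t) dt and W(b,q) = ∫_b^{b+a/q} h(t) dt (with integrands extended to be zero outside [b̲, b̄] or defined only where b + a/q ≤ b̄). Then λ is weakly increasing on [b̲, b̄] if and only if for every q ≥ 2 and every pair of grid points b₁ > b₂ of the form b̲ + (j/q)·a with j ∈ {0,1,…,q−1}, one has M(b₂,q)·W(b₁,q) − M(b₁,q)·W(b₂,q) ≤ 0. -/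

import Mathlib

open Set MeasureTheory

lemma intervalIntegrable_of_pos_of_le {c d M : ℝ} {h : ℝ → ℝ} (hcd : c ≤ d)
    (hmeas : Measurable h) (hh : ∀ t ∈ Icc c d, 0 < h t ∧ h t ≤ M) :
    IntervalIntegrable h volume c d := by
  rw [intervalIntegrable_iff_integrableOn_Icc_of_le hcd]
  refine Measure.integrableOn_of_bounded (M := M) (by simp)
    hmeas.aestronglyMeasurable ?_
  filter_upwards [ae_restrict_mem measurableSet_Icc] with t ht
  rw [Real.norm_of_nonneg (hh t ht).1.le]
  exact (hh t ht).2

lemma integral_mul_le_of_le {c d M K : ℝ} {f h : ℝ → ℝ} (hcd : c ≤ d)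
    (hf : ContinuousOn f (Icc c d)) (hmeas : Measurable h)
    (hh : ∀ t ∈ Icc c d, 0 < h t ∧ h t ≤ M) (hK : ∀ t ∈ Icc c d, f t ≤ K) :
    ∫ t in c..d, f t * h t ≤ K * ∫ t in c..d, h t := by
  have hi := intervalIntegrable_of_pos_of_le hcd hmeas hh
  rw [← intervalIntegral.integral_const_mul]
  refine intervalIntegral.integral_mono_on hcd
    (hi.continuousOn_mul (by rwa [uIcc_of_le hcd])) (hi.const_mul K) fun t ht => ?_
  exact mul_le_mul_of_nonneg_right (hK t ht) (hh t ht).1.le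

lemma le_integral_mul_of_le {c d M K : ℝ} {f h : ℝ → ℝ} (hcd : c ≤ d)
    (hf : ContinuousOn f (Icc c d)) (hmeas : Measurable h)
    (hh : ∀ t ∈ Icc c d, 0 < h t ∧ h t ≤ M) (hK : ∀ t ∈ Icc c d, K ≤ f t) :
    K * ∫ t in c..d, h t ≤ ∫ t in c..d, f t * h t := by
  have hi := intervalIntegrable_of_pos_of_le hcd hmeas hh
  rw [← intervalIntegral.integral_const_mul]
  refine intervalIntegral.integral_mono_on hcd (hi.const_mul K)
    (hi.continuousOn_mul (by rwa [uIcc_of_le hcd])) fun t ht => ?_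
  exact mul_le_mul_of_nonneg_right (hK t ht) (hh t ht).1.le

lemma integral_pos_of_pos_of_le {c d M : ℝ} {h : ℝ → ℝ} (hcd : c < d)
    (hmeas : Measurable h) (hh : ∀ t ∈ Icc c d, 0 < h t ∧ h t ≤ M) :
    0 < ∫ t in c..d, h t :=
  intervalIntegral.intervalIntegral_pos_of_pos_on
    (intervalIntegrable_of_pos_of_le hcd.le hmeas hh)
    (fun t ht => (hh t (Ioo_subset_Icc_self ht)).1) hcd

lemma grid_cell_subset {u v : ℝ} (huv : u < v) {q j : ℕ} (hj : j < q) :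
    Icc (u + ((j : ℝ) / q) * (v - u)) (u + ((j : ℝ) / q) * (v - u) + (v - u) / q) ⊆
      Icc u v := by
  have hq : (0 : ℝ) < q := by exact_mod_cast (Nat.zero_le j).trans_lt hj
  have hj' : (j : ℝ) + 1 ≤ q := by exact_mod_cast hj
  have ha : 0 < v - u := sub_pos.2 huv
  refine Icc_subset_Icc (le_add_of_nonneg_right (by positivity)) ?_
  have h1 : ((j : ℝ) + 1) / q * (v - u) ≤ 1 * (v - u) := by
    gcongr
    exact (div_le_one hq).2 hj'
  have h2 : ((j : ℝ) + 1) / q * (v - u) = (j : ℝ) / q * (v - u) + (v - u) / q := by ring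
  linarith

lemma grid_cell_end_le_start {u v : ℝ} (huv : u < v) {q i j : ℕ} (hij : i < j) :
    u + ((i : ℝ) / q) * (v - u) + (v - u) / q ≤ u + ((j : ℝ) / q) * (v - u) := by
  have hij' : (i : ℝ) + 1 ≤ j := by exact_mod_cast hij
  have ha : 0 < v - u := sub_pos.2 huv
  have h1 : ((i : ℝ) + 1) / q * (v - u) ≤ (j : ℝ) / q * (v - u) := by gcongr
  have h2 : ((i : ℝ) + 1) / q * (v - u) = (i : ℝ) / q * (v - u) + (v - u) / q := by ring
  linarith

lemma exists_mem_grid_cell {u v x : ℝ} (huv : u < v) (hx : x ∈ Icc u v) {q : ℕ} (hq : 0 < q) :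
    ∃ j < q, x ∈ Icc (u + ((j : ℝ) / q) * (v - u))
      (u + ((j : ℝ) / q) * (v - u) + (v - u) / q) := by
  have hq' : (0 : ℝ) < q := by exact_mod_cast hq
  have ha : 0 < v - u := sub_pos.2 huv
  rcases hx.2.eq_or_lt with rfl | hxv
  · refine ⟨q - 1, by omega, ?_⟩
    rw [Nat.cast_sub hq, Nat.cast_one, sub_div, div_self hq'.ne']
    have : 0 < (x - u) / q := by positivity
    have h2 : (1 - 1 / (q : ℝ)) * (x - u) = (x - u) - (x - u) / q := by ring
    rw [h2]
    constructor <;> linarith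
  · set y := (x - u) / (v - u) * q with hy
    have hy0 : 0 ≤ y := by
      have := sub_nonneg.2 hx.1
      positivity
    have hxy : x = u + y / q * (v - u) := by
      rw [hy]
      field_simp
      ring
    have hyq : y < q := by
      have : (x - u) / (v - u) < 1 := (div_lt_one ha).2 (by linarith)
      nlinarith
    refine ⟨⌊y⌋₊, (Nat.floor_lt hy0).2 hyq, ?_, ?_⟩
    · rw [hxy]
      gcongr
      exact Nat.floor_le hy0
    · have h1 : y / q * (v - u) ≤ ((⌊y⌋₊ : ℝ) + 1) / q * (v - u) := by
        gcongr
        exact (Nat.lt_floor_add_one y).le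
      have h2 : ((⌊y⌋₊ : ℝ) + 1) / q * (v - u) =
        (⌊y⌋₊ : ℝ) / q * (v - u) + (v - u) / q := by ring
      linarith

/-- Monotonicity of `λ` on `[b̲, b̄]` is equivalent to the countable family of
moment inequalities `M(b₂,q)W(b₁,q) − M(b₁,q)W(b₂,q) ≤ 0` over grid points. -/
theorem stmt4 (bl bu Mb : ℝ) (hblt : bl < bu)
    (lam h : ℝ → ℝ)
    (hlamc : ContinuousOn lam (Icc bl bu))
    (hmeas : Measurable h)
    (hh : ∀ b ∈ Icc bl bu, 0 < h b ∧ h b ≤ Mb) :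
    MonotoneOn lam (Icc bl bu) ↔
      ∀ q : ℕ, 2 ≤ q → ∀ j₁ j₂ : ℕ, j₁ < q → j₂ < q → j₂ < j₁ →
        (∫ t in (bl + ((j₂ : ℝ) / q) * (bu - bl))..(bl + ((j₂ : ℝ) / q) * (bu - bl) + (bu - bl) / q),
            lam t * h t) *
          (∫ t in (bl + ((j₁ : ℝ) / q) * (bu - bl))..(bl + ((j₁ : ℝ) / q) * (bu - bl) + (bu - bl) / q),
            h t) -
        (∫ t in (bl + ((j₁ : ℝ) / q) * (bu - bl))..(bl + ((j₁ : ℝ) / q) * (bu - bl) + (bu - bl) / q),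
            lam t * h t) *
          (∫ t in (bl + ((j₂ : ℝ) / q) * (bu - bl))..(bl + ((j₂ : ℝ) / q) * (bu - bl) + (bu - bl) / q),
            h t) ≤ 0 := by
  have ha : 0 < bu - bl := sub_pos.2 hblt
  constructor
  · intro hmono q hq j₁ j₂ hj₁ hj₂ hlt
    have hd : 0 < (bu - bl) / q := div_pos ha (by exact_mod_cast (by omega : 0 < q))
    have hs₁ := grid_cell_subset hblt hj₁
    have hs₂ := grid_cell_subset hblt hj₂
    have hle := grid_cell_end_le_start hblt (q := q) hlt
    set c₁ := bl + ((j₁ : ℝ) / q) * (bu - bl)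
    set c₂ := bl + ((j₂ : ℝ) / q) * (bu - bl)
    have hc₁ := hs₁ (left_mem_Icc.2 (by linarith))
    have hW₁ := integral_pos_of_pos_of_le (by linarith) hmeas fun t ht => hh t (hs₁ ht)
    have hW₂ := integral_pos_of_pos_of_le (by linarith) hmeas fun t ht => hh t (hs₂ ht)
    have hM₂ := integral_mul_le_of_le (K := lam c₁) (by linarith) (hlamc.mono hs₂) hmeas
      (fun t ht => hh t (hs₂ ht)) fun t ht => hmono (hs₂ ht) hc₁ (ht.2.trans hle)
    have hM₁ := le_integral_mul_of_le (K := lam c₁) (by linarith) (hlamc.mono hs₁) hmeas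
      (fun t ht => hh t (hs₁ ht)) fun t ht => hmono hc₁ (hs₁ ht) ht.1
    have h₁ := mul_le_mul_of_nonneg_right hM₁ hW₂.le
    have h₂ := mul_le_mul_of_nonneg_right hM₂ hW₁.le
    linarith
  · intro H x hx y hy hxy
    by_contra! hlt
    obtain ⟨K₁, hK₁y, hK₁x⟩ := exists_between hlt
    obtain ⟨K₂, hK₂y, hK₂⟩ := exists_between hK₁y
    obtain ⟨δ₁, hδ₁, hball₁⟩ := Metric.mem_nhdsWithin_iff.1
      ((hlamc x hx).eventually (lt_mem_nhds hK₁x))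
    obtain ⟨δ₂, hδ₂, hball₂⟩ := Metric.mem_nhdsWithin_iff.1
      ((hlamc y hy).eventually (gt_mem_nhds hK₂y))
    obtain ⟨n, hn⟩ := exists_nat_gt ((bu - bl) / min δ₁ δ₂)
    obtain ⟨q, hq, hnq⟩ : ∃ q : ℕ, 2 ≤ q ∧ n ≤ q := ⟨max 2 n, le_max_left _ _, le_max_right _ _⟩
    have hq0 : (0 : ℝ) < q := by exact_mod_cast (by omega : 0 < q)
    have hd : 0 < (bu - bl) / q := div_pos ha hq0
    have hsmall : (bu - bl) / q < min δ₁ δ₂ :=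
      (div_lt_comm₀ (lt_min hδ₁ hδ₂) hq0).1 (hn.trans_le (by exact_mod_cast hnq))
    have hsmall₁ := hsmall.trans_le (min_le_left _ _)
    have hsmall₂ := hsmall.trans_le (min_le_right _ _)
    obtain ⟨i, hi, hxi⟩ := exists_mem_grid_cell hblt hx (by omega : 0 < q)
    obtain ⟨j, hj, hyj⟩ := exists_mem_grid_cell hblt hy (by omega : 0 < q)
    have hsi := grid_cell_subset hblt hi
    have hsj := grid_cell_subset hblt hj
    have hge : ∀ t ∈ Icc (bl + ((i : ℝ) / q) * (bu - bl))
        (bl + ((i : ℝ) / q) * (bu - bl) + (bu - bl) / q), K₁ < lam t := fun t ht =>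
      hball₁ ⟨by rw [Metric.mem_ball, Real.dist_eq, abs_lt]
                 constructor <;> linarith [ht.1, ht.2, hxi.1, hxi.2], hsi ht⟩
    have hle : ∀ t ∈ Icc (bl + ((j : ℝ) / q) * (bu - bl))
        (bl + ((j : ℝ) / q) * (bu - bl) + (bu - bl) / q), lam t < K₂ := fun t ht =>
      hball₂ ⟨by rw [Metric.mem_ball, Real.dist_eq, abs_lt]
                 constructor <;> linarith [ht.1, ht.2, hyj.1, hyj.2], hsj ht⟩
    have hij : i < j := by
      rcases lt_trichotomy i j with hij | rfl | hji
      · exact hij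
      · linarith [hle x hxi]
      · have hyx : y ≤ x := hyj.2.trans ((grid_cell_end_le_start hblt hji).trans hxi.1)
        rw [le_antisymm hxy hyx] at hlt
        exact absurd hlt (lt_irrefl _)
    have key := H q hq j i hj hi hij
    have hWi := integral_pos_of_pos_of_le (by linarith) hmeas fun t ht => hh t (hsi ht)
    have hWj := integral_pos_of_pos_of_le (by linarith) hmeas fun t ht => hh t (hsj ht)
    have hMi := le_integral_mul_of_le (by linarith) (hlamc.mono hsi) hmeas
      (fun t ht => hh t (hsi ht)) fun t ht => (hge t ht).le
    have hMj := integral_mul_le_of_le (by linarith) (hlamc.mono hsj) hmeas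
      (fun t ht => hh t (hsj ht)) fun t ht => (hle t ht).le
    have h₁ := mul_le_mul_of_nonneg_right hMi hWj.le
    have h₂ := mul_le_mul_of_nonneg_right hMj hWi.le
    have h₃ := mul_pos (sub_pos.2 hK₂) (mul_pos hWi hWj)
    linarith
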